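/- Let A_1, …, A_n be distinct points in ℝ³ with charges ζ_1, …, ζ_n > 0, and let V(x) = Σ_{i=1}^n ζ_i/‖x − A_i‖ on ℝ³ ∖ {A_1, …, A_n}. If every critical point of V is non-degenerate (i.e. the Hessian of V is invertible there), then V has at least n − 1 critical points. -/

import Mathlib

noncomputable section

open Finset

abbrev E3 := EuclideanSpace ℝ (Fin 3)

/-- The electrostatic potential of `n` point charges of magnitudes `ζ i` at points `A i`. -/
def pot {n : ℕ} (A : Fin n → E3) (ζ : Fin n → ℝ) : E3 → ℝ :=
  fun x => ∑ i, ζ i / ‖x - A i‖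

open Topology Filter

section Topological

variable {X : Type*} [TopologicalSpace X] {f : X → ℝ}

/-- If all sublevel sets of a continuous function are compact, then every neighbourhood of a
sublevel set contains a slightly larger one. -/
theorem exists_sublevel_subset_of_isOpen (hf : Continuous f)
    (hcpt : ∀ c, IsCompact {x | f x ≤ c}) {c : ℝ} {N : Set X} (hN : IsOpen N)
    (h : {x | f x ≤ c} ⊆ N) : ∃ d > c, {x | f x ≤ d} ⊆ N := by
  by_cases hne : ({x | f x ≤ c + 1} \ N).Nonempty
  · obtain ⟨q, hq, hmin⟩ := ((hcpt (c + 1)).diff hN).exists_isMinOn hne hf.continuousOn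
    have hcq : c < f q := by
      by_contra! hle
      exact hq.2 (h hle)
    refine ⟨(c + min (f q) (c + 1)) / 2, ?_, fun x hx => ?_⟩
    · have := lt_min hcq (lt_add_one c)
      simp only [gt_iff_lt]; linarith
    · by_contra hxN
      have h1 := min_le_left (f q) (c + 1)
      have h2 := min_le_right (f q) (c + 1)
      simp only [Set.mem_ofPred_eq] at hx
      have h3 : f q ≤ f x := hmin ⟨by simp only [Set.mem_ofPred_eq]; linarith, hxN⟩
      linarith
  · refine ⟨c + 1, by simp, fun x hx => ?_⟩
    by_contra hxN
    exact hne ⟨x, hx, hxN⟩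

/-- A path in an open sublevel set stays in a strictly lower sublevel set. -/
theorem JoinedIn.exists_lt_sublevel (hf : Continuous f) {c : ℝ} {x y : X}
    (h : JoinedIn {z | f z < c} x y) : ∃ d < c, JoinedIn {z | f z ≤ d} x y := by
  obtain ⟨γ, hγ⟩ := h
  obtain ⟨t, -, ht⟩ := (isCompact_univ : IsCompact (Set.univ : Set unitInterval)).exists_isMaxOn
    Set.univ_nonempty (hf.comp γ.continuous).continuousOn
  exact ⟨f (γ t), hγ t, γ, fun s => ht (Set.mem_univ s)⟩

/-- Minimum principle: each path component of an open sublevel set contains a point of any set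
outside of which `f` has no local minimum. -/
theorem exists_joinedIn_sublevel [LocallyPathConnectedSpace X] (hf : Continuous f)
    (hcpt : ∀ c, IsCompact {x | f x ≤ c}) {Z : Set X}
    (hmin : ∀ p ∉ Z, p ∈ closure {x | f x < f p}) {c : ℝ} {x : X} (hx : f x < c) :
    ∃ z ∈ Z, JoinedIn {y | f y < c} z x := by
  have hopen : IsOpen {y | f y < c} := isOpen_lt hf continuous_const
  set U := pathComponentIn {y | f y < c} x with hU
  have hUo : IsOpen U := hopen.pathComponentIn x
  have hUsub : ∀ ⦃y⦄, y ∈ U → f y < c := fun y hy => JoinedIn.target_mem (F := {y | f y < c}) hy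
  have hsub : closure U ⊆ {y | f y ≤ c} :=
    closure_minimal (fun y hy => (hUsub hy).le) (isClosed_le hf continuous_const)
  have hxU : x ∈ U := mem_pathComponentIn_self hx
  obtain ⟨q, hq, hqmin⟩ := ((hcpt c).of_isClosed_subset isClosed_closure hsub).exists_isMinOn
    ⟨x, subset_closure hxU⟩ hf.continuousOn
  have hqc : f q < c := (hqmin (subset_closure hxU)).trans_lt hx
  have hqU : q ∈ U := by
    obtain ⟨y, hy, hyU⟩ := mem_closure_iff.1 hq _ (hopen.pathComponentIn q)
      (mem_pathComponentIn_self hqc)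
    exact JoinedIn.trans hyU (JoinedIn.symm hy)
  refine ⟨q, ?_, JoinedIn.symm hqU⟩
  by_contra hqZ
  obtain ⟨y, hyU, hy⟩ := mem_closure_iff.1 (hmin q hqZ) U hUo hqU
  have hyq : f y < f q := hy
  exact hyq.not_ge (hqmin (subset_closure hyU))

/-- A mountain pass argument: if near every `p` outside the zero set `A` the part below the level
`f p` meets only the path components of `A (e p).1` and `A (e p).2`, then for every nontrivial
partition `S`, `Sᶜ` of the index set some pair `e p` has one entry in each part. -/
theorem exists_saddle_of_partition [T2Space X] [PathConnectedSpace X]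
    [LocallyPathConnectedSpace X] {ι : Type*} {A : ι → X} [Finite ι]
    (hA : Function.Injective A) (hf : Continuous f) (hcpt : ∀ c, IsCompact {x | f x ≤ c})
    (hnn : ∀ x, 0 ≤ f x) (h0 : ∀ x, f x = 0 ↔ x ∈ Set.range A)
    (hmin : ∀ p ∉ Set.range A, p ∈ closure {x | f x < f p})
    (e : X → ι × ι)
    (he : ∀ p ∉ Set.range A, ∀ᶠ x in 𝓝 p, f x < f p →
      JoinedIn {y | f y < f p} (A (e p).1) x ∨ JoinedIn {y | f y < f p} (A (e p).2) x)
    {S : Set ι} (hS : S.Nonempty) (hSc : Sᶜ.Nonempty) :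
    ∃ p ∉ Set.range A, ((e p).1 ∈ S ∧ (e p).2 ∉ S) ∨ ((e p).1 ∉ S ∧ (e p).2 ∈ S) := by
  by_contra! hcon
  let D : Set ℝ := {c | 0 ≤ c ∧ ∀ i ∈ S, ∀ j ∉ S, ¬ JoinedIn {x | f x < c} (A i) (A j)}
  have hfA : ∀ i, f (A i) = 0 := fun i => (h0 _).2 ⟨i, rfl⟩
  have h0D : (0 : ℝ) ∈ D := ⟨le_rfl, fun i _ j _ h => (h.source_mem.trans_le' (hnn _)).false⟩
  have hstep : ∀ c ∈ D, ∃ d ∈ D, c < d := by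
    rintro c ⟨hc0, hc⟩
    let W : Set ι → Set X := fun R => {x | ∃ i ∈ R, JoinedIn {y | f y < c} (A i) x}
    have hWsub : ∀ R, W R ⊆ {x | f x ≤ c} := fun R x ⟨i, _, h⟩ => le_of_lt (a := f x) h.target_mem
    let K : Set ι → Set X := fun R => closure (W R) ∪ A '' R
    have hKc : ∀ R, IsCompact (K R) := fun R =>
      ((hcpt c).of_isClosed_subset isClosed_closure
        (closure_minimal (hWsub R) (isClosed_le hf continuous_const))).union
        ((Set.toFinite _).isCompact)
    have hopen : IsOpen {y | f y < c} := isOpen_lt hf continuous_const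
    have hWo : ∀ R, IsOpen (W R) := fun R => by
      have : W R = ⋃ i ∈ R, pathComponentIn {y | f y < c} (A i) := by
        ext x; simp [W, pathComponentIn]
      rw [this]
      exact isOpen_biUnion fun i _ => hopen.pathComponentIn _
    have hWd : Disjoint (W S) (W Sᶜ) := by
      refine Set.disjoint_left.2 ?_
      rintro x ⟨i, hi, hix⟩ ⟨j, hj, hjx⟩
      exact hc i hi j hj (hix.trans hjx.symm)
    have hcov : ∀ x, f x < c → x ∈ W S ∨ x ∈ W Sᶜ := fun x hx => by
      obtain ⟨_, ⟨i, rfl⟩, hi⟩ := exists_joinedIn_sublevel hf hcpt hmin hx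
      by_cases hiS : i ∈ S
      exacts [Or.inl ⟨i, hiS, hi⟩, Or.inr ⟨i, hiS, hi⟩]
    have hcpos : ∀ R x, x ∈ closure (W R) → 0 < c := fun R x hx => by
      obtain ⟨y, i, -, hy⟩ := closure_nonempty_iff.1 ⟨x, hx⟩
      exact (hnn y).trans_lt hy.target_mem
    have hWA : ∀ R, ∀ i ∈ R, 0 < c → A i ∈ W R := fun R i hi hc0 =>
      ⟨i, hi, JoinedIn.refl (by simpa [hfA] using hc0)⟩
    have hd1 : Disjoint (W S) (closure (W Sᶜ)) := hWd.closure_right (hWo S)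
    have hd2 : Disjoint (closure (W S)) (W Sᶜ) := hWd.closure_left (hWo Sᶜ)
    have hKd : Disjoint (K S) (K Sᶜ) := by
      refine Set.disjoint_left.2 ?_
      rintro x (hx | ⟨i, hi, rfl⟩) (hx' | ⟨j, hj, hij⟩)
      · have hxc : ¬ f x < c := fun hlt => (hcov x hlt).elim
          (fun h => Set.disjoint_left.1 hd1 h hx') (fun h => Set.disjoint_left.1 hd2 hx h)
        have hfx : f x = c := le_antisymm
          (closure_minimal (hWsub S) (isClosed_le hf continuous_const) hx) (not_lt.1 hxc)
        have hxA : x ∉ Set.range A := fun h => by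
          rw [← h0, hfx] at h
          exact (hcpos _ _ hx).ne' h
        have hx2 := he x hxA
        rw [hfx] at hx2
        obtain ⟨y, hy, hyS⟩ := (mem_closure_iff_nhds.1 hx _ hx2)
        obtain ⟨y', hy', hyS'⟩ := (mem_closure_iff_nhds.1 hx' _ hx2)
        have hyc : f y < c := by obtain ⟨k, -, hk⟩ := hyS; exact hk.target_mem
        have hyc' : f y' < c := by obtain ⟨k, -, hk⟩ := hyS'; exact hk.target_mem
        have hinS : ∀ k, JoinedIn {y | f y < c} (A k) y → k ∈ S := fun k hk => by
          by_contra hkS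
          exact Set.disjoint_left.1 hWd hyS ⟨k, hkS, hk⟩
        have hninS : ∀ k, JoinedIn {y | f y < c} (A k) y' → k ∉ S := fun k hk hkS =>
          Set.disjoint_left.1 hWd ⟨k, hkS, hk⟩ hyS'
        obtain ⟨hcon1, hcon2⟩ := hcon x hxA
        rcases hy hyc with h1 | h1 <;> rcases hy' hyc' with h2 | h2
        · exact hninS _ h2 (hinS _ h1)
        · exact hninS _ h2 (hcon1 (hinS _ h1))
        · exact hcon2 (hninS _ h2) (hinS _ h1)
        · exact hninS _ h2 (hinS _ h1)
      · subst hij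
        exact Set.disjoint_left.1 hd2 hx (hWA _ _ hj (hcpos _ _ hx))
      · exact Set.disjoint_left.1 hd1 (hWA _ _ hi (hcpos _ _ hx')) hx'
      · exact hj (hA hij ▸ hi)
    obtain ⟨N, N', hN, hN', hKN, hKN', hNN⟩ :=
      SeparatedNhds.of_isCompact_isCompact (hKc S) (hKc Sᶜ) hKd
    have hcovK : {x | f x ≤ c} ⊆ N ∪ N' := by
      intro x hx
      have : x ∈ K S ∪ K Sᶜ := by
        by_cases hxA : x ∈ Set.range A
        · obtain ⟨i, rfl⟩ := hxA
          by_cases hi : i ∈ S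
          exacts [Or.inl (Or.inr ⟨i, hi, rfl⟩), Or.inr (Or.inr ⟨i, hi, rfl⟩)]
        · have h1 : x ∈ closure (W S ∪ W Sᶜ) :=
            closure_mono (fun y hy => hcov y (lt_of_lt_of_le (b := f x) hy hx)) (hmin x hxA)
          rw [closure_union] at h1
          exact h1.imp Or.inl Or.inl
      exact this.imp (fun h => hKN h) (fun h => hKN' h)
    obtain ⟨d, hd, hdN⟩ := exists_sublevel_subset_of_isOpen hf hcpt (hN.union hN') hcovK
    refine ⟨d, ⟨hc0.trans hd.le, fun i hi j hj hij => ?_⟩, hd⟩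
    obtain ⟨γ, hγ⟩ := hij
    have hr : Set.range γ ⊆ N ∪ N' := by
      rintro _ ⟨t, rfl⟩
      exact hdN (le_of_lt (a := f (γ t)) (hγ t))
    have hi' : A i ∈ N := hKN (Or.inr ⟨i, hi, rfl⟩)
    have hj' : A j ∈ N' := hKN' (Or.inr ⟨j, hj, rfl⟩)
    rcases (isPreconnected_range γ.continuous).subset_or_subset hN hN' hNN hr with h | h
    · exact Set.disjoint_left.1 hNN (h ⟨1, γ.target⟩) hj'
    · exact Set.disjoint_left.1 hNN hi' (h ⟨0, γ.source⟩)
  obtain ⟨i, hi⟩ := hS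
  obtain ⟨j, hj⟩ := hSc
  obtain ⟨M, hM⟩ : ∃ M, JoinedIn {x | f x < M} (A i) (A j) := by
    let γ := PathConnectedSpace.somePath (A i) (A j)
    obtain ⟨t, -, ht⟩ := (isCompact_univ : IsCompact (Set.univ : Set unitInterval)).exists_isMaxOn
      Set.univ_nonempty (hf.comp γ.continuous).continuousOn
    refine ⟨f (γ t) + 1, γ, fun s => ?_⟩
    have : f (γ s) ≤ f (γ t) := ht (Set.mem_univ s)
    exact this.trans_lt (lt_add_one _)
  have hbdd : BddAbove D := by
    refine ⟨M, fun c hc => ?_⟩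
    by_contra! h
    exact hc.2 i hi j hj (hM.mono fun x hx => lt_trans (b := M) hx h)
  have hsup : sSup D ∈ D := by
    refine ⟨le_csSup hbdd h0D, fun k hk l hl h => ?_⟩
    obtain ⟨d, hd, hjoin⟩ := h.exists_lt_sublevel hf
    obtain ⟨c, hc, hdc⟩ := exists_lt_of_lt_csSup ⟨0, h0D⟩ hd
    exact hc.2 k hk l hl (hjoin.mono fun x hx => lt_of_le_of_lt (b := d) hx hdc)
  obtain ⟨d, hd, hlt⟩ := hstep _ hsup
  exact (le_csSup hbdd hd).not_gt hlt

/-- A nonnegative proper function with a finite zero set, whose positive critical points are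
saddles adjacent to at most two path components of the lower level set, has at least
`|zero set| - 1` critical points. -/
theorem card_le_card_saddles_add_one [T2Space X] [PathConnectedSpace X]
    [LocallyPathConnectedSpace X] {ι : Type*} {A : ι → X} [Finite ι] [Nonempty ι]
    (hA : Function.Injective A) (hf : Continuous f) (hcpt : ∀ c, IsCompact {x | f x ≤ c})
    (hnn : ∀ x, 0 ≤ f x) (h0 : ∀ x, f x = 0 ↔ x ∈ Set.range A)
    (hmin : ∀ p ∉ Set.range A, p ∈ closure {x | f x < f p}) (C : Finset X)
    (hreg : ∀ p ∉ Set.range A, p ∉ C →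
      ∃ a, ∀ᶠ x in 𝓝 p, f x < f p → JoinedIn {y | f y < f p} a x)
    (hsad : ∀ p ∈ C, ∃ a b, ∀ᶠ x in 𝓝 p, f x < f p →
      JoinedIn {y | f y < f p} a x ∨ JoinedIn {y | f y < f p} b x) :
    Nat.card ι ≤ C.card + 1 := by
  classical
  have hrep : ∀ (c : ℝ) (a : X), ∃ i, ∀ x, JoinedIn {y | f y < c} a x →
      JoinedIn {y | f y < c} (A i) x := fun c a => by
    by_cases ha : f a < c
    · obtain ⟨_, ⟨i, rfl⟩, hi⟩ := exists_joinedIn_sublevel hf hcpt hmin ha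
      exact ⟨i, fun x hx => hi.trans hx⟩
    · exact ⟨Classical.arbitrary ι, fun x hx => (ha hx.source_mem).elim⟩
  have hex : ∀ p, ∃ e : ι × ι, p ∉ Set.range A → (p ∉ C → e.1 = e.2) ∧
      ∀ᶠ x in 𝓝 p, f x < f p →
        JoinedIn {y | f y < f p} (A e.1) x ∨ JoinedIn {y | f y < f p} (A e.2) x := fun p => by
    by_cases hpA : p ∈ Set.range A
    · exact ⟨Classical.arbitrary _, fun h => (h hpA).elim⟩
    by_cases hpC : p ∈ C
    · obtain ⟨a, b, hab⟩ := hsad p hpC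
      obtain ⟨i, hi⟩ := hrep (f p) a
      obtain ⟨j, hj⟩ := hrep (f p) b
      exact ⟨(i, j), fun _ => ⟨fun h => (h hpC).elim,
        hab.mono fun x hx hlt => (hx hlt).imp (hi x) (hj x)⟩⟩
    · obtain ⟨a, ha⟩ := hreg p hpA hpC
      obtain ⟨i, hi⟩ := hrep (f p) a
      exact ⟨(i, i), fun _ => ⟨fun _ => rfl, ha.mono fun x hx hlt => Or.inl (hi x (hx hlt))⟩⟩
  choose e he using hex
  let s : Finset (Sym2 ι) := C.image fun p => s((e p).1, (e p).2)
  let G : SimpleGraph ι := SimpleGraph.fromEdgeSet s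
  have hconn : G.Connected := by
    rw [SimpleGraph.connected_iff_exists_forall_reachable]
    refine ⟨Classical.arbitrary ι, ?_⟩
    by_contra! hne
    obtain ⟨j, hj⟩ := hne
    set i := Classical.arbitrary ι
    obtain ⟨p, hpA, hp⟩ := exists_saddle_of_partition hA hf hcpt hnn h0 hmin e
      (fun p hp => (he p hp).2) (S := {k | G.Reachable i k})
      ⟨i, SimpleGraph.Reachable.refl i⟩ ⟨j, hj⟩
    have hadj : (e p).1 ≠ (e p).2 → G.Adj (e p).1 (e p).2 := fun hne => by
      refine (SimpleGraph.fromEdgeSet_adj _).2 ⟨?_, hne⟩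
      have hpC : p ∈ C := by
        by_contra h
        exact hne ((he p hpA).1 h)
      exact Finset.mem_coe.2 (Finset.mem_image_of_mem _ hpC)
    rcases hp with ⟨h1, h2⟩ | ⟨h1, h2⟩
    · exact h2 (SimpleGraph.Reachable.trans h1
        (hadj fun h => h2 (h ▸ h1)).reachable)
    · exact h1 (SimpleGraph.Reachable.trans h2
        (hadj fun h => h1 (h ▸ h2)).symm.reachable)
  refine hconn.card_vert_le_card_edgeSet_add_one.trans (Nat.succ_le_succ ?_)
  have hsub : G.edgeSet ⊆ (s : Set (Sym2 ι)) := by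
    rw [SimpleGraph.edgeSet_fromEdgeSet]
    exact Set.sdiff_subset
  calc Nat.card G.edgeSet ≤ Nat.card (s : Set (Sym2 ι)) := Nat.card_mono s.finite_toSet hsub
    _ = s.card := by simp
    _ ≤ C.card := Finset.card_image_le

end Topological

section Local

open scoped InnerProductSpace

variable {E : Type*} [NormedAddCommGroup E] [InnerProductSpace ℝ E]

theorem strictMonoOn_comp_of_inner_gradient_pos [CompleteSpace E] {V : E → ℝ} {G : E → E}
    {γ γ' : ℝ → E} {a b : ℝ} (hγ : ∀ t ∈ Set.Icc a b, HasDerivAt γ (γ' t) t)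
    (hV : ∀ t ∈ Set.Icc a b, HasGradientAt V (G (γ t)) (γ t))
    (hpos : ∀ t ∈ Set.Ioo a b, 0 < ⟪G (γ t), γ' t⟫_ℝ) :
    StrictMonoOn (fun t => V (γ t)) (Set.Icc a b) := by
  have hd : ∀ t ∈ Set.Icc a b, HasDerivAt (fun t => V (γ t)) ⟪G (γ t), γ' t⟫_ℝ t := fun t ht =>
    (hV t ht).hasFDerivAt.comp_hasDerivAt t (hγ t ht)
  refine strictMonoOn_of_deriv_pos (convex_Icc a b)
    (fun t ht => (hd t ht).continuousAt.continuousWithinAt) fun t ht => ?_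
  rw [interior_Icc] at ht
  rw [(hd t (Set.Ioo_subset_Icc_self ht)).deriv]
  exact hpos t ht

theorem lt_add_of_inner_gradient_pos [CompleteSpace E] {V : E → ℝ} {G : E → E} {p u : E}
    (hV : ∀ t ∈ Set.Icc (0 : ℝ) 1, HasGradientAt V (G (p + t • u)) (p + t • u))
    (hpos : ∀ t ∈ Set.Ioo (0 : ℝ) 1, 0 < ⟪G (p + t • u), u⟫_ℝ) : V p < V (p + u) := by
  have h := strictMonoOn_comp_of_inner_gradient_pos (γ := fun t => p + t • u) (γ' := fun _ => u)
    (fun t _ => by simpa using ((hasDerivAt_id t).smul_const u).const_add p) hV hpos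
    (Set.left_mem_Icc.2 zero_le_one) (Set.right_mem_Icc.2 zero_le_one) zero_lt_one
  simpa using h

/-- Near a regular point, the strict superlevel set is path connected. -/
theorem exists_joinedIn_superlevel_of_gradient_ne_zero [CompleteSpace E] {V : E → ℝ} {G : E → E}
    {p : E} {N : Set E}
    (hN : N ∈ 𝓝 p) (hV : ∀ᶠ x in 𝓝 p, HasGradientAt V (G x) x) (hG : ContinuousAt G p)
    (hp : G p ≠ 0) :
    p ∈ closure (N ∩ {x | V p < V x}) ∧
      ∃ a, ∀ᶠ x in 𝓝 p, V p < V x → JoinedIn (N ∩ {x | V p < V x}) a x := by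
  set u := G p with hu
  have hpos : ∀ᶠ x in 𝓝 p, 0 < ⟪G x, u⟫_ℝ := by
    have : Tendsto (fun x => ⟪G x, u⟫_ℝ) (𝓝 p) (𝓝 ⟪G p, u⟫_ℝ) := hG.inner tendsto_const_nhds
    exact this.eventually_const_lt (real_inner_self_pos.2 hp)
  obtain ⟨r, hr, hball⟩ := Metric.eventually_nhds_iff.1 ((hV.and hpos).and hN)
  have hu0 : 0 < ‖u‖ := norm_pos_iff.2 hp
  have hup : ∀ x, ∀ δ > 0, dist x p + δ * ‖u‖ < r → V x < V (x + δ • u) := fun x δ hδ hlt => by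
    have hmem : ∀ t ∈ Set.Icc (0 : ℝ) 1, dist (x + t • δ • u) p < r := fun t ht => by
      calc dist (x + t • δ • u) p ≤ dist (x + t • δ • u) x + dist x p := dist_triangle _ _ _
        _ = t * (δ * ‖u‖) + dist x p := by
          rw [dist_self_add_left, norm_smul, norm_smul, Real.norm_of_nonneg ht.1,
            Real.norm_of_nonneg hδ.le]
        _ ≤ 1 * (δ * ‖u‖) + dist x p := by gcongr; exact ht.2
        _ < r := by linarith
    refine lt_add_of_inner_gradient_pos (G := G) (fun t ht => (hball (hmem t ht)).1.1)
      fun t ht => ?_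
    rw [inner_smul_right]
    exact mul_pos hδ (hball (hmem t (Set.Ioo_subset_Icc_self ht))).1.2
  have hO : IsOpen (Metric.ball p r ∩ V ⁻¹' Set.Ioi (V p)) :=
    ContinuousOn.isOpen_inter_preimage
      (fun x hx => (hball hx).1.1.hasFDerivAt.continuousAt.continuousWithinAt)
      Metric.isOpen_ball isOpen_Ioi
  have hOsub : Metric.ball p r ∩ V ⁻¹' Set.Ioi (V p) ⊆ N ∩ {x | V p < V x} :=
    fun x hx => ⟨(hball hx.1).2, hx.2⟩
  set δ := r / (2 * ‖u‖) with hδ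
  have hδ0 : 0 < δ := by positivity
  have hδu : δ * ‖u‖ = r / 2 := by rw [hδ]; field_simp
  have hmem : ∀ t ∈ Set.Ioc (0 : ℝ) 1,
      p + (t * δ) • u ∈ Metric.ball p r ∩ V ⁻¹' Set.Ioi (V p) := fun t ht => by
    have h1 : t * δ * ‖u‖ < r := by
      rw [mul_assoc, hδu]; nlinarith [ht.2]
    have h0 : 0 < t * δ := mul_pos ht.1 hδ0
    refine ⟨?_, hup p _ h0 (by simpa using h1)⟩
    rw [Metric.mem_ball, dist_self_add_left, norm_smul, Real.norm_of_nonneg h0.le]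
    exact h1
  constructor
  · have hlim : Tendsto (fun t : ℝ => p + (t * δ) • u) (𝓝[>] 0) (𝓝 p) := by
      have : Continuous fun t : ℝ => p + (t * δ) • u := by fun_prop
      simpa using (this.tendsto 0).mono_left nhdsWithin_le_nhds
    refine mem_closure_of_tendsto hlim ?_
    filter_upwards [Ioc_mem_nhdsGT (zero_lt_one' ℝ)] with t ht using hOsub (hmem t ht)
  · have hqO := hmem 1 (by simp)
    rw [one_mul] at hqO
    obtain ⟨ρ, hρ, hρO⟩ := Metric.isOpen_iff.1 hO _ hqO
    refine ⟨p + δ • u, ?_⟩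
    filter_upwards [Metric.ball_mem_nhds p (lt_min hρ (half_pos hr))] with x hx hVx
    rw [Metric.mem_ball, lt_min_iff] at hx
    have hseg : JoinedIn (N ∩ {x | V p < V x}) x (x + δ • u) := by
      refine JoinedIn.ofLine (f := fun t => x + (t * δ) • u) (by fun_prop) (by simp) (by simp) ?_
      rintro _ ⟨t, ht, rfl⟩
      rcases ht.1.eq_or_lt with rfl | ht0
      · simpa using hOsub ⟨by rw [Metric.mem_ball]; linarith [hx.2], hVx⟩
      have h0 : 0 < t * δ := mul_pos ht0 hδ0
      have h1 : t * δ * ‖u‖ ≤ r / 2 := by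
        rw [mul_assoc, hδu]; nlinarith [ht.2]
      refine hOsub ⟨?_, hVx.trans (hup x _ h0 (by linarith [hx.2]))⟩
      calc dist (x + (t * δ) • u) p ≤ dist (x + (t * δ) • u) x + dist x p := dist_triangle _ _ _
        _ = t * δ * ‖u‖ + dist x p := by
          rw [dist_self_add_left, norm_smul, Real.norm_of_nonneg h0.le]
        _ < r := by linarith [hx.2]
    have hball' : JoinedIn (N ∩ {x | V p < V x}) (x + δ • u) (p + δ • u) :=
      (((convex_ball _ _).isPathConnected ⟨_, Metric.mem_ball_self hρ⟩).joinedIn _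
        (by simpa using hx.1) _ (Metric.mem_ball_self hρ)).mono (hρO.trans hOsub)
    exact (hseg.trans hball').symm

/-- A sphere in a nontrivial subspace has at most two path components. -/
theorem exists_joinedIn_sphere_or {F : Type*} [NormedAddCommGroup F] [InnerProductSpace ℝ F]
    [Nontrivial F] [FiniteDimensional ℝ F] {δ : ℝ} (hδ : 0 ≤ δ) :
    ∃ a b : F, ∀ x ∈ Metric.sphere (0 : F) δ,
      JoinedIn (Metric.sphere 0 δ) a x ∨ JoinedIn (Metric.sphere 0 δ) b x := by
  obtain ⟨v, hv⟩ := exists_norm_eq F hδ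
  rcases (Nat.succ_le_iff.2 (Module.finrank_pos (R := ℝ) (M := F))).eq_or_lt with h1 | h1
  · refine ⟨v, -v, fun x hx => ?_⟩
    obtain ⟨u, hu0, hu⟩ := finrank_eq_one_iff'.1 h1.symm
    obtain ⟨c, rfl⟩ := hu v
    obtain ⟨d, rfl⟩ := hu x
    have hdc : |d| = |c| := by
      rw [mem_sphere_zero_iff_norm, ← hv, norm_smul, norm_smul] at hx
      exact mul_right_cancel₀ (norm_ne_zero_iff.2 hu0) hx
    rcases abs_eq_abs.1 hdc with rfl | rfl
    · exact Or.inl (JoinedIn.refl hx)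
    · rw [neg_smul] at hx ⊢
      exact Or.inr (JoinedIn.refl hx)
  · have hrank : 1 < Module.rank ℝ F := by
      rw [← Module.finrank_eq_rank]; exact_mod_cast h1
    exact ⟨v, v, fun x hx => Or.inl ((isPathConnected_sphere hrank 0 hδ).joinedIn v (by simpa) x hx)⟩

/-- Near a nondegenerate critical point, the strict superlevel set has at most two path
components. Here `K` is a maximal subspace on which the second derivative `L` is positive. -/
theorem exists_joinedIn_superlevel_of_nondegenerate [FiniteDimensional ℝ E] {V : E → ℝ}
    {G : E → E}
    {L : E →L[ℝ] E} {p : E} {N : Set E} (hN : N ∈ 𝓝 p)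
    (hV : ∀ᶠ x in 𝓝 p, HasGradientAt V (G x) x) (hG : HasFDerivAt G L p) (hp : G p = 0)
    (K : Submodule ℝ E) [Nontrivial K] {μ : ℝ} (hμ : 0 < μ)
    (hL : ∀ s ∈ K, ∀ w ∈ Kᗮ, μ * ‖s + w‖ ^ 2 ≤ ⟪L (s + w), s - w⟫_ℝ) :
    p ∈ closure (N ∩ {x | V p < V x}) ∧
      ∃ a b, ∀ᶠ x in 𝓝 p, V p < V x →
        JoinedIn (N ∩ {x | V p < V x}) a x ∨ JoinedIn (N ∩ {x | V p < V x}) b x := by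
  have hnorm : ∀ s ∈ K, ∀ w ∈ Kᗮ, ‖s - w‖ = ‖s + w‖ := fun s hs w hw => by
    have h := K.inner_right_of_mem_orthogonal hs hw
    rw [← sq_eq_sq₀ (norm_nonneg _) (norm_nonneg _), norm_sub_sq_real, norm_add_sq_real, h]
    ring
  have hpos : ∀ᶠ y in 𝓝 (0 : E), ∀ s ∈ K, ∀ w ∈ Kᗮ, y = s + w → y ≠ 0 →
      0 < ⟪G (p + y), s - w⟫_ℝ := by
    have h := (hasFDerivAt_iff_isLittleO_nhds_zero.1 hG).def (half_pos hμ)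
    filter_upwards [h] with y hy s hs w hw hsw hy0
    rw [hp, sub_zero] at hy
    have h1 : |⟪G (p + y) - L y, s - w⟫_ℝ| ≤ μ / 2 * ‖y‖ * ‖y‖ := by
      calc _ ≤ ‖G (p + y) - L y‖ * ‖s - w‖ := abs_real_inner_le_norm _ _
        _ ≤ _ := by rw [hnorm s hs w hw, ← hsw]; gcongr
    have h2 := hL s hs w hw
    rw [← hsw] at h2
    rw [inner_sub_left, abs_le] at h1
    have h3 : 0 < ‖y‖ := norm_pos_iff.2 hy0
    nlinarith [h1.1, mul_pos hμ (mul_pos h3 h3)]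
  have hsub : Tendsto (fun y => p + y) (𝓝 0) (𝓝 p) := by
    simpa using (continuous_const_add p).tendsto 0
  obtain ⟨r, hr, hball⟩ := Metric.eventually_nhds_iff.1
    ((hpos.and (hsub.eventually hV)).and (hsub hN))
  simp only [dist_zero_right] at hball
  have hup : ∀ s ∈ K, s ≠ 0 → ‖s‖ < r → V p < V (p + s) := fun s hs hs0 hsr => by
    have hmem : ∀ t ∈ Set.Icc (0 : ℝ) 1, ‖t • s‖ < r := fun t ht => by
      rw [norm_smul, Real.norm_of_nonneg ht.1]
      nlinarith [norm_nonneg s, ht.2]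
    refine lt_add_of_inner_gradient_pos (G := G) (fun t ht => (hball (hmem t ht)).1.2)
      fun t ht => ?_
    have h := (hball (hmem t (Set.Ioo_subset_Icc_self ht))).1.1 (t • s) (K.smul_mem t hs) 0
      (Submodule.zero_mem _) (by simp) (smul_ne_zero ht.1.ne' hs0)
    rw [sub_zero, inner_smul_right] at h
    exact pos_of_mul_pos_right h ht.1.le
  have hdown : ∀ w ∈ Kᗮ, ‖w‖ < r → V (p + w) ≤ V p := fun w hw hwr => by
    rcases eq_or_ne w 0 with rfl | hw0
    · simp
    have hmem : ∀ t ∈ Set.Icc (0 : ℝ) 1, ‖t • w‖ < r := fun t ht => by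
      rw [norm_smul, Real.norm_of_nonneg ht.1]
      nlinarith [norm_nonneg w, ht.2]
    have := lt_add_of_inner_gradient_pos (V := fun x => -V x) (G := fun x => -G x) (p := p) (u := w)
      (fun t ht => by
        have := (hball (hmem t ht)).1.2.hasFDerivAt.neg
        rw [hasGradientAt_iff_hasFDerivAt, map_neg]
        exact this)
      fun t ht => by
        have h := (hball (hmem t (Set.Ioo_subset_Icc_self ht))).1.1 0 (Submodule.zero_mem _) (t • w)
          (Submodule.smul_mem _ t hw) (by simp) (smul_ne_zero ht.1.ne' hw0)
        rw [zero_sub, inner_neg_right, ← inner_neg_left, inner_smul_right] at h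
        exact pos_of_mul_pos_right h ht.1.le
    linarith
  have hO : IsOpen (Metric.ball p r ∩ V ⁻¹' Set.Ioi (V p)) :=
    ContinuousOn.isOpen_inter_preimage
      (fun x hx => by
        have := (hball (y := x - p) (by rwa [← dist_eq_norm])).1.2
        rw [add_sub_cancel] at this
        exact this.hasFDerivAt.continuousAt.continuousWithinAt)
      Metric.isOpen_ball isOpen_Ioi
  have hOsub : Metric.ball p r ∩ V ⁻¹' Set.Ioi (V p) ⊆ N ∩ {x | V p < V x} :=
    fun x hx => ⟨by
      have := (hball (y := x - p) (by rw [← dist_eq_norm]; exact hx.1)).2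
      rwa [add_sub_cancel] at this, hx.2⟩
  have hKO : ∀ s ∈ K, s ≠ 0 → ‖s‖ < r → p + s ∈ Metric.ball p r ∩ V ⁻¹' Set.Ioi (V p) :=
    fun s hs hs0 hsr => ⟨by simpa using hsr, hup s hs hs0 hsr⟩
  constructor
  · obtain ⟨⟨v, hvK⟩, hv⟩ := exists_ne (0 : K)
    have hv0 : v ≠ 0 := fun h => hv (by simp [h])
    have hlim : Tendsto (fun t : ℝ => t • v) (𝓝[>] 0) (𝓝 0) := by
      have : Continuous fun t : ℝ => t • v := by fun_prop
      simpa using (this.tendsto 0).mono_left nhdsWithin_le_nhds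
    refine mem_closure_of_tendsto (hsub.comp hlim) ?_
    filter_upwards [self_mem_nhdsWithin, hlim (Metric.ball_mem_nhds 0 hr)] with t ht htr
    exact hOsub (hKO _ (K.smul_mem t hvK) (smul_ne_zero (ne_of_gt ht) hv0) (by simpa using htr))
  · let S : Set E := (fun s : K => p + (s : E)) '' Metric.sphere 0 (r / 2)
    have hScont : Continuous fun s : K => p + (s : E) := by fun_prop
    have hSO : S ⊆ Metric.ball p r ∩ V ⁻¹' Set.Ioi (V p) := by
      rintro _ ⟨s, hs, rfl⟩
      rw [mem_sphere_zero_iff_norm, Submodule.coe_norm] at hs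
      exact hKO s s.2 (norm_pos_iff.1 (by linarith)) (by linarith)
    obtain ⟨ρ, hρ, hρO⟩ :=
      ((isCompact_sphere (0 : K) (r / 2)).image hScont).exists_thickening_subset_open hO hSO
    have hjoin : ∀ᶠ x in 𝓝 p, V p < V x →
        ∃ q ∈ S, JoinedIn (N ∩ {x | V p < V x}) q x := by
      filter_upwards [Metric.ball_mem_nhds p (lt_min hρ (half_pos hr))] with x hx hVx
      rw [Metric.mem_ball, lt_min_iff] at hx
      obtain ⟨s, hs, w, hw, hsw⟩ := K.exists_add_mem_mem_orthogonal (x - p)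
      have hx' : x = p + (s + w) := by rw [← hsw, add_sub_cancel]
      have hsw0 : ⟪s, w⟫_ℝ = 0 := K.inner_right_of_mem_orthogonal hs hw
      have hsq : ‖s + w‖ ^ 2 = ‖s‖ ^ 2 + ‖w‖ ^ 2 := by rw [norm_add_sq_real, hsw0]; ring
      have hxn : ‖s + w‖ = dist x p := by rw [← hsw, dist_eq_norm]
      have hsle : ‖s‖ ≤ dist x p := by
        rw [← hxn]; exact abs_le_of_sq_le_sq' (by nlinarith [sq_nonneg ‖w‖]) (norm_nonneg _) |>.2
      have hwle : ‖w‖ ≤ dist x p := by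
        rw [← hxn]; exact abs_le_of_sq_le_sq' (by nlinarith [sq_nonneg ‖s‖]) (norm_nonneg _) |>.2
      have hs0 : s ≠ 0 := by
        rintro rfl
        have := hdown w hw (by linarith [hx.2])
        rw [hx', zero_add] at hVx
        exact hVx.not_ge this
      have hsn : 0 < ‖s‖ := norm_pos_iff.2 hs0
      set T := Real.log (r / 2 / ‖s‖) with hT
      have hexpT : Real.exp T * ‖s‖ = r / 2 := by
        rw [hT, Real.exp_log (by positivity)]; field_simp
      have hT0 : 0 < T := Real.log_pos (by rw [lt_div_iff₀ hsn]; linarith [hx.2])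
      let γ : ℝ → E := fun t => Real.exp t • s + Real.exp (-t) • w
      have hγn : ∀ t ∈ Set.Icc 0 T, ‖γ t‖ < r := fun t ht => by
        calc ‖γ t‖ ≤ Real.exp t * ‖s‖ + Real.exp (-t) * ‖w‖ := by
              refine (norm_add_le _ _).trans_eq ?_
              rw [norm_smul, norm_smul, Real.norm_of_nonneg (Real.exp_pos _).le,
                Real.norm_of_nonneg (Real.exp_pos _).le]
          _ ≤ Real.exp T * ‖s‖ + 1 * ‖w‖ := by
              gcongr
              exacts [ht.2, Real.exp_le_one_iff.2 (neg_nonpos.2 ht.1)]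
          _ < r := by rw [hexpT]; linarith [hx.2]
      have hγ0 : ∀ t, γ t ≠ 0 := fun t h => by
        have h1 : ⟪s, γ t⟫_ℝ = Real.exp t * ‖s‖ ^ 2 := by
          simp only [γ, inner_add_right, inner_smul_right, hsw0, real_inner_self_eq_norm_sq,
            mul_zero, add_zero]
        rw [h, inner_zero_right] at h1
        exact (mul_pos (Real.exp_pos t) (pow_pos hsn 2)).ne h1
      have hmono : StrictMonoOn (fun t => V (p + γ t)) (Set.Icc 0 T) := by
        refine strictMonoOn_comp_of_inner_gradient_pos (G := G)
          (γ' := fun t => Real.exp t • s - Real.exp (-t) • w) (fun t _ => ?_)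
          (fun t ht => (hball (hγn t ht)).1.2) fun t ht => ?_
        · have h1 := (Real.hasDerivAt_exp t).smul_const s
          have h2 := ((hasDerivAt_neg t).exp).smul_const w
          have e : Real.exp t • s - Real.exp (-t) • w
              = Real.exp t • s + (Real.exp (-t) * -1) • w := by
            rw [mul_neg_one, neg_smul, sub_eq_add_neg]
          rw [e]
          exact (h1.add h2).const_add p
        · exact (hball (hγn t (Set.Ioo_subset_Icc_self ht))).1.1 _ (K.smul_mem _ hs) _
            (Submodule.smul_mem _ _ hw) rfl (hγ0 t)
      have htraj : JoinedIn (N ∩ {x | V p < V x}) x (p + γ T) := by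
        refine JoinedIn.ofLine (f := fun t => p + γ (t * T)) (by fun_prop) (by simp [γ, hx'])
          (by simp) ?_
        rintro _ ⟨t, ht, rfl⟩
        have htT : t * T ∈ Set.Icc 0 T :=
          ⟨mul_nonneg ht.1 hT0.le, by nlinarith [ht.2]⟩
        refine hOsub ⟨by simpa using hγn _ htT, ?_⟩
        have h := hmono.monotoneOn (Set.left_mem_Icc.2 hT0.le) htT htT.1
        refine hVx.trans_le ?_
        simpa [γ, hx'] using h
      have hqS : p + Real.exp T • s ∈ S :=
        ⟨⟨Real.exp T • s, K.smul_mem _ hs⟩, by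
          rw [mem_sphere_zero_iff_norm, Submodule.coe_norm, norm_smul,
            Real.norm_of_nonneg (Real.exp_pos _).le, hexpT], rfl⟩
      refine ⟨_, hqS, JoinedIn.symm (htraj.trans ?_)⟩
      refine (((convex_ball (p + Real.exp T • s) ρ).isPathConnected
        ⟨_, Metric.mem_ball_self hρ⟩).joinedIn _ ?_ _ (Metric.mem_ball_self hρ)).mono
        (((Metric.ball_subset_thickening hqS ρ).trans hρO).trans hOsub)
      have : p + γ T = p + Real.exp T • s + Real.exp (-T) • w := by simp only [γ, add_assoc]
      rw [this, Metric.mem_ball, dist_self_add_left, norm_smul,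
        Real.norm_of_nonneg (Real.exp_pos _).le]
      have : Real.exp (-T) ≤ 1 := Real.exp_le_one_iff.2 (neg_nonpos.2 hT0.le)
      nlinarith [norm_nonneg w, hx.1]
    obtain ⟨a, b, hab⟩ := exists_joinedIn_sphere_or (F := K) (half_pos hr).le
    refine ⟨p + a, p + b, hjoin.mono fun x hx hVx => ?_⟩
    obtain ⟨_, ⟨s, hs, rfl⟩, hsx⟩ := hx hVx
    exact (hab s hs).imp
      (fun h => ((h.map hScont).mono (hSO.trans hOsub)).trans hsx)
      (fun h => ((h.map hScont).mono (hSO.trans hOsub)).trans hsx)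

end Local

section Spectral

open scoped InnerProductSpace

variable {E : Type*} [NormedAddCommGroup E] [InnerProductSpace ℝ E]

/-- A trace-free nondegenerate symmetric operator is uniformly positive on some nontrivial subspace
and uniformly negative on its orthogonal complement. -/
theorem exists_positive_subspace_of_trace_eq_zero [FiniteDimensional ℝ E] [Nontrivial E]
    {L : E →ₗ[ℝ] E} (hsymm : L.IsSymmetric) (hinj : ∀ v, v ≠ 0 → L v ≠ 0)
    (htr : LinearMap.trace ℝ E L = 0) :
    ∃ K : Submodule ℝ E, Nontrivial K ∧ ∃ μ > 0, ∀ s ∈ K, ∀ w ∈ Kᗮ,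
      μ * ‖s + w‖ ^ 2 ≤ ⟪L (s + w), s - w⟫_ℝ := by
  set b := hsymm.eigenvectorBasis rfl with hb
  set ev := hsymm.eigenvalues rfl with hev
  have hLb : ∀ i, L (b i) = ev i • b i := fun i => hsymm.apply_eigenvectorBasis rfl i
  have hev0 : ∀ i, ev i ≠ 0 := fun i h => by
    refine hinj (b i) (b.orthonormal.ne_zero i) ?_
    rw [hLb, h, zero_smul]
  have hsum : ∑ i, ev i = 0 := by
    rw [← htr, LinearMap.trace_eq_sum_inner L b]
    refine Finset.sum_congr rfl fun i _ => ?_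
    rw [hLb, inner_smul_right, real_inner_self_eq_norm_sq, b.orthonormal.1 i]
    simp
  have : Nonempty (Fin (Module.finrank ℝ E)) := ⟨⟨0, Module.finrank_pos⟩⟩
  obtain ⟨i₀, hi₀⟩ : ∃ i, 0 < ev i := by
    by_contra! h
    exact (Finset.sum_neg (fun i _ => (h i).lt_of_ne (hev0 i)) Finset.univ_nonempty).ne hsum
  obtain ⟨m, hm⟩ := Finite.exists_min fun i => |ev i|
  let K : Submodule ℝ E := Submodule.span ℝ (b '' {i | 0 < ev i})
  have hbK : ∀ i, 0 < ev i → b i ∈ K := fun i hi => Submodule.subset_span ⟨i, hi, rfl⟩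
  have hK : ∀ s ∈ K, ∀ i, ev i < 0 → ⟪b i, s⟫_ℝ = 0 := fun s hs i hi => by
    induction hs using Submodule.span_induction with
    | mem x hx =>
      obtain ⟨j, hj, rfl⟩ := hx
      exact b.orthonormal.2 fun h => lt_asymm hi (h ▸ hj)
    | zero => simp
    | add x y _ _ hx hy => rw [inner_add_right, hx, hy, add_zero]
    | smul a x _ hx => rw [inner_smul_right, hx, mul_zero]
  refine ⟨K, ?_, |ev m|, abs_pos.2 (hev0 m), fun s hs w hw => ?_⟩
  · exact (Submodule.nontrivial_iff_ne_bot).2 fun h => b.orthonormal.ne_zero i₀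
      ((Submodule.mem_bot ℝ).1 (h ▸ hbK i₀ hi₀))
  · rw [← b.sum_sq_norm_inner_right, ← b.sum_inner_mul_inner, Finset.mul_sum]
    refine Finset.sum_le_sum fun i _ => ?_
    rw [hsymm, hLb, inner_smul_right, ← real_inner_comm (s + w), inner_add_right, inner_sub_right,
      Real.norm_eq_abs, sq_abs]
    have hmi := hm i
    rcases (hev0 i).lt_or_gt with hi | hi
    · rw [hK s hs i hi]
      rw [abs_of_neg hi] at hmi
      nlinarith [sq_nonneg ⟪b i, w⟫_ℝ]
    · rw [K.inner_right_of_mem_orthogonal (hbK i hi) hw]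
      rw [abs_of_pos hi] at hmi
      nlinarith [sq_nonneg ⟪b i, s⟫_ℝ]

end Spectral

section Potential

open scoped InnerProductSpace

/-- The derivative of the vector field `y ↦ -y / ‖y‖ ^ 3`. -/
def coulombHessian (y : E3) : E3 →L[ℝ] E3 :=
  (3 * (‖y‖ ^ 5)⁻¹) • (innerSL ℝ y).smulRight y - (‖y‖ ^ 3)⁻¹ • ContinuousLinearMap.id ℝ E3

theorem coulombHessian_apply (y v : E3) :
    coulombHessian y v = (3 * (‖y‖ ^ 5)⁻¹ * ⟪y, v⟫_ℝ) • y - (‖y‖ ^ 3)⁻¹ • v := by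
  simp [coulombHessian, smul_smul]

theorem coulombHessian_isSymmetric (y : E3) :
    (coulombHessian y : E3 →ₗ[ℝ] E3).IsSymmetric := fun v w => by
  simp only [ContinuousLinearMap.coe_coe, coulombHessian_apply, inner_sub_left, inner_sub_right,
    real_inner_smul_left, real_inner_smul_right, real_inner_comm y v]
  ring

theorem trace_coulombHessian {y : E3} (hy : y ≠ 0) :
    LinearMap.trace ℝ E3 (coulombHessian y : E3 →ₗ[ℝ] E3) = 0 := by
  have h0 : ‖y‖ ≠ 0 := norm_ne_zero_iff.2 hy
  let b := EuclideanSpace.basisFun (Fin 3) ℝ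
  have hb : ∀ j, ⟪b j, coulombHessian y (b j)⟫_ℝ =
      3 * (‖y‖ ^ 5)⁻¹ * ‖⟪b j, y⟫_ℝ‖ ^ 2 - (‖y‖ ^ 3)⁻¹ := fun j => by
    rw [coulombHessian_apply, inner_sub_right, real_inner_smul_right, real_inner_smul_right,
      real_inner_self_eq_norm_sq, b.orthonormal.1 j, real_inner_comm, Real.norm_eq_abs, sq_abs]
    ring
  rw [LinearMap.trace_eq_sum_inner _ b]
  simp only [ContinuousLinearMap.coe_coe, hb]
  rw [Finset.sum_sub_distrib, ← Finset.mul_sum, b.sum_sq_norm_inner_right, Finset.sum_const,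
    Finset.card_univ, Fintype.card_fin, nsmul_eq_mul]
  field_simp
  norm_num

theorem hasFDerivAt_norm_sub {x a : E3} (h : x ≠ a) :
    HasFDerivAt (fun x : E3 => ‖x - a‖) (‖x - a‖⁻¹ • innerSL ℝ (x - a)) x := by
  have h0 : ‖x - a‖ ≠ 0 := norm_ne_zero_iff.2 (sub_ne_zero.2 h)
  have h1 := (((hasFDerivAt_id (𝕜 := ℝ) x).sub_const a).norm_sq).sqrt (pow_ne_zero 2 h0)
  simp only [id, Real.sqrt_sq (norm_nonneg _)] at h1
  refine h1.congr_fderiv ?_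
  ext1 v
  change 1 / (2 * ‖x - a‖) * (2 • ⟪x - a, v⟫_ℝ) = ‖x - a‖⁻¹ * ⟪x - a, v⟫_ℝ
  rw [two_nsmul]
  field_simp
  ring

theorem hasFDerivAt_div_norm_sub {x a : E3} (h : x ≠ a) (z : ℝ) :
    HasFDerivAt (fun x : E3 => z / ‖x - a‖)
      (InnerProductSpace.toDual ℝ E3 (-(z • (‖x - a‖ ^ 3)⁻¹ • (x - a)))) x := by
  have h0 : ‖x - a‖ ≠ 0 := norm_ne_zero_iff.2 (sub_ne_zero.2 h)
  have h1 := ((hasDerivAt_inv h0).comp_hasFDerivAt x (hasFDerivAt_norm_sub h)).const_mul z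
  refine h1.congr_fderiv ?_
  ext1 v
  change z * (-(‖x - a‖ ^ 2)⁻¹ * (‖x - a‖⁻¹ * ⟪x - a, v⟫_ℝ)) = ⟪_, v⟫_ℝ
  rw [inner_neg_left, real_inner_smul_left, real_inner_smul_left]
  field_simp

theorem hasFDerivAt_coulombField {x a : E3} (h : x ≠ a) (z : ℝ) :
    HasFDerivAt (fun x : E3 => -(z • (‖x - a‖ ^ 3)⁻¹ • (x - a)))
      (z • coulombHessian (x - a)) x := by
  have h0 : ‖x - a‖ ≠ 0 := norm_ne_zero_iff.2 (sub_ne_zero.2 h)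
  have h1 : HasFDerivAt (fun x : E3 => (‖x - a‖ ^ 3)⁻¹)
      ((-(3 * (‖x - a‖ ^ 5)⁻¹)) • innerSL ℝ (x - a)) x := by
    refine ((hasDerivAt_inv (pow_ne_zero 3 h0)).comp_hasFDerivAt x
      ((hasFDerivAt_norm_sub h).pow 3)).congr_fderiv ?_
    rw [smul_smul, smul_smul]
    congr 1
    rw [nsmul_eq_mul]
    field_simp
    norm_num [mul_comm]
  have h2 := ((h1.fun_smul ((hasFDerivAt_id (𝕜 := ℝ) x).sub_const a)).const_smul z).neg
  refine h2.congr_fderiv ?_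
  rw [← smul_neg, coulombHessian]
  congr 1
  ext1 v
  simp only [id_eq, neg_add_rev, add_apply, neg_apply,
    ContinuousLinearMap.smulRight_apply, smul_apply, neg_smul, neg_neg, smul_assoc, sub_eq_add_neg]

variable {n : ℕ} (A : Fin n → E3) (ζ : Fin n → ℝ)

/-- The gradient of `pot A ζ` away from the charges. -/
def potGradient (x : E3) : E3 := ∑ i, -(ζ i • (‖x - A i‖ ^ 3)⁻¹ • (x - A i))

/-- The derivative of `potGradient A ζ` away from the charges. -/
def potHessian (x : E3) : E3 →L[ℝ] E3 := ∑ i, ζ i • coulombHessian (x - A i)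

variable {A ζ} {x : E3}

theorem hasGradientAt_pot (hx : ∀ i, x ≠ A i) : HasGradientAt (pot A ζ) (potGradient A ζ x) x := by
  rw [hasGradientAt_iff_hasFDerivAt, potGradient, map_sum]
  exact HasFDerivAt.fun_sum fun i _ => hasFDerivAt_div_norm_sub (hx i) (ζ i)

theorem hasFDerivAt_potGradient (hx : ∀ i, x ≠ A i) :
    HasFDerivAt (potGradient A ζ) (potHessian A ζ x) x :=
  HasFDerivAt.fun_sum fun i _ => hasFDerivAt_coulombField (hx i) (ζ i)

theorem potHessian_isSymmetric (x : E3) :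
    (potHessian A ζ x : E3 →ₗ[ℝ] E3).IsSymmetric := fun v w => by
  have h : ∀ i, ⟪coulombHessian (x - A i) v, w⟫_ℝ = ⟪v, coulombHessian (x - A i) w⟫_ℝ :=
    fun i => coulombHessian_isSymmetric (x - A i) v w
  simp [potHessian, sum_inner, inner_sum, real_inner_smul_left, real_inner_smul_right, h]

theorem trace_potHessian (hx : ∀ i, x ≠ A i) :
    LinearMap.trace ℝ E3 (potHessian A ζ x : E3 →ₗ[ℝ] E3) = 0 := by
  simp [potHessian, trace_coulombHessian (sub_ne_zero.2 (hx _))]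

theorem eventually_forall_ne (hx : ∀ i, x ≠ A i) : ∀ᶠ y in 𝓝 x, ∀ i, y ≠ A i :=
  Filter.eventually_all.2 fun i => isOpen_ne.mem_nhds (hx i)

theorem fderiv_pot_eq_zero_iff (hx : ∀ i, x ≠ A i) :
    fderiv ℝ (pot A ζ) x = 0 ↔ potGradient A ζ x = 0 := by
  rw [(hasGradientAt_pot hx).hasFDerivAt.fderiv, LinearIsometryEquiv.map_eq_zero_iff]

theorem fderiv_fderiv_pot_apply (hx : ∀ i, x ≠ A i) (v : E3) :
    fderiv ℝ (fderiv ℝ (pot A ζ)) x v = InnerProductSpace.toDual ℝ E3 (potHessian A ζ x v) := by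
  have h : fderiv ℝ (pot A ζ) =ᶠ[𝓝 x]
      fun y => InnerProductSpace.toDual ℝ E3 (potGradient A ζ y) :=
    (eventually_forall_ne hx).mono fun y hy => (hasGradientAt_pot hy).hasFDerivAt.fderiv
  rw [h.fderiv_eq]
  have h2 := (innerSL ℝ (E := E3)).hasFDerivAt.comp x (hasFDerivAt_potGradient (ζ := ζ) hx)
  have h3 : HasFDerivAt (fun y => InnerProductSpace.toDual ℝ E3 (potGradient A ζ y)) _ x := h2
  rw [h3.fderiv]
  rfl

end Potential

section InversePotential

variable {n : ℕ} (A : Fin n → E3) (ζ : Fin n → ℝ)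

/-- The reciprocal of the potential, extended by zero at the charges. -/
def invPot (x : E3) : ℝ := ((∑ i, ENNReal.ofReal (ζ i) * ‖x - A i‖ₑ⁻¹)⁻¹).toReal

variable {A ζ} {x : E3}

theorem continuous_invPot [NeZero n] (hζ : ∀ i, 0 < ζ i) : Continuous (invPot A ζ) := by
  refine ENNReal.continuousOn_toReal.comp_continuous ?_ fun x => ?_
  · refine continuous_inv.comp (continuous_finsetSum _ fun i _ => ?_)
    refine (ENNReal.continuous_const_mul ENNReal.ofReal_ne_top).comp ?_
    exact continuous_inv.comp (by fun_prop)
  · have h : ENNReal.ofReal (ζ 0) * ‖x - A 0‖ₑ⁻¹ ≠ 0 :=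
      mul_ne_zero (by simpa using hζ 0) (ENNReal.inv_ne_zero.2 enorm_ne_top)
    simp only [Set.mem_ofPred_eq, ne_eq, ENNReal.inv_eq_top, Finset.sum_eq_zero_iff, not_forall]
    exact ⟨0, Finset.mem_univ _, h⟩

theorem invPot_eq_inv_pot (hζ : ∀ i, 0 < ζ i) (hx : ∀ i, x ≠ A i) :
    invPot A ζ x = (pot A ζ x)⁻¹ := by
  have h0 : ∀ i, ‖x - A i‖ₑ ≠ 0 := fun i => by simpa [sub_eq_zero] using hx i
  rw [invPot, ENNReal.toReal_inv, ENNReal.toReal_sum fun i _ =>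
    ENNReal.mul_ne_top ENNReal.ofReal_ne_top (ENNReal.inv_ne_top.2 (h0 i))]
  simp [pot, div_eq_mul_inv, ENNReal.toReal_ofReal (hζ _).le]

theorem invPot_apply_self (hζ : ∀ i, 0 < ζ i) (i : Fin n) : invPot A ζ (A i) = 0 := by
  have h : ∑ j, ENNReal.ofReal (ζ j) * ‖A i - A j‖ₑ⁻¹ = ⊤ := by
    refine ENNReal.sum_eq_top.2 ⟨i, Finset.mem_univ i, ?_⟩
    rw [sub_self, enorm_zero, ENNReal.inv_zero]
    exact ENNReal.mul_top (by simpa using hζ i)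
  rw [invPot, h]
  simp

theorem pot_pos [NeZero n] (hζ : ∀ i, 0 < ζ i) (hx : ∀ i, x ≠ A i) : 0 < pot A ζ x :=
  Finset.sum_pos (fun i _ => div_pos (hζ i) (norm_pos_iff.2 (sub_ne_zero.2 (hx i))))
    Finset.univ_nonempty

theorem invPot_eq_zero_iff [NeZero n] (hζ : ∀ i, 0 < ζ i) :
    invPot A ζ x = 0 ↔ x ∈ Set.range A := by
  refine ⟨fun h => ?_, ?_⟩
  · by_contra hx
    have hx' : ∀ i, x ≠ A i := fun i hi => hx ⟨i, hi.symm⟩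
    rw [invPot_eq_inv_pot hζ hx'] at h
    exact (inv_pos.2 (pot_pos hζ hx')).ne' h
  · rintro ⟨i, rfl⟩
    exact invPot_apply_self hζ i

theorem isCompact_invPot_le [NeZero n] (hζ : ∀ i, 0 < ζ i) (c : ℝ) :
    IsCompact {x | invPot A ζ x ≤ c} := by
  have hZ : 0 < ∑ i, ζ i := Finset.sum_pos (fun i _ => hζ i) Finset.univ_nonempty
  set R := (|c| + 1) * ∑ i, ζ i with hR
  have hR0 : 0 < R := by positivity
  refine (isCompact_iUnion fun i => isCompact_closedBall (A i) R).of_isClosed_subset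
    (isClosed_le (continuous_invPot hζ) continuous_const) fun x hx => ?_
  by_contra hxR
  simp only [Set.mem_iUnion, Metric.mem_closedBall, not_exists, not_le, dist_eq_norm] at hxR
  have hxA : ∀ i, x ≠ A i := by
    rintro i rfl
    have := hxR i
    rw [sub_self, norm_zero] at this
    linarith
  have hlt : pot A ζ x < (|c| + 1)⁻¹ := by
    calc pot A ζ x < ∑ i, ζ i / R := Finset.sum_lt_sum_of_nonempty Finset.univ_nonempty
          fun i _ => div_lt_div_of_pos_left (hζ i) hR0 (hxR i)
      _ = (|c| + 1)⁻¹ := by rw [← Finset.sum_div, hR]; field_simp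
  have h1 : invPot A ζ x ≤ c := hx
  rw [invPot_eq_inv_pot hζ hxA] at h1
  have h2 := (lt_inv_comm₀ (pot_pos hζ hxA) (by positivity)).1 hlt
  linarith [le_abs_self c]

theorem invPot_lt_of_pot_lt [NeZero n] (hζ : ∀ i, 0 < ζ i) {p : E3} (hp : ∀ i, p ≠ A i)
    (hx : ∀ i, x ≠ A i) : invPot A ζ x < invPot A ζ p ↔ pot A ζ p < pot A ζ x := by
  rw [invPot_eq_inv_pot hζ hp, invPot_eq_inv_pot hζ hx,
    inv_lt_inv₀ (pot_pos hζ hx) (pot_pos hζ hp)]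

end InversePotential

section MorseCount

variable {n : ℕ} {A : Fin n → E3} {ζ : Fin n → ℝ}

theorem exists_joinedIn_invPot_lt_of_regular [NeZero n] (hζ : ∀ i, 0 < ζ i) {p : E3}
    (hp : ∀ i, p ≠ A i) (hcrit : fderiv ℝ (pot A ζ) p ≠ 0) :
    p ∈ closure {x | invPot A ζ x < invPot A ζ p} ∧
      ∃ a, ∀ᶠ x in 𝓝 p, invPot A ζ x < invPot A ζ p →
        JoinedIn {y | invPot A ζ y < invPot A ζ p} a x := by
  have hne := eventually_forall_ne hp
  have hsub : {y | ∀ i, y ≠ A i} ∩ {x | pot A ζ p < pot A ζ x} ⊆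
      {x | invPot A ζ x < invPot A ζ p} := fun x hx => (invPot_lt_of_pot_lt hζ hp hx.1).2 hx.2
  obtain ⟨hcl, a, ha⟩ := exists_joinedIn_superlevel_of_gradient_ne_zero hne
    (hne.mono fun x hx => hasGradientAt_pot (ζ := ζ) hx)
    (hasFDerivAt_potGradient hp).continuousAt (mt (fderiv_pot_eq_zero_iff hp).2 hcrit)
  refine ⟨closure_mono hsub hcl, a, ?_⟩
  filter_upwards [ha, hne] with x hx hxA hlt
  exact (hx ((invPot_lt_of_pot_lt hζ hp hxA).1 hlt)).mono hsub

theorem exists_joinedIn_invPot_lt_of_critical [NeZero n] (hζ : ∀ i, 0 < ζ i) {p : E3}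
    (hp : ∀ i, p ≠ A i) (hcrit : fderiv ℝ (pot A ζ) p = 0)
    (hnd : ∀ v : E3, v ≠ 0 → fderiv ℝ (fderiv ℝ (pot A ζ)) p v ≠ 0) :
    p ∈ closure {x | invPot A ζ x < invPot A ζ p} ∧
      ∃ a b, ∀ᶠ x in 𝓝 p, invPot A ζ x < invPot A ζ p →
        JoinedIn {y | invPot A ζ y < invPot A ζ p} a x ∨
          JoinedIn {y | invPot A ζ y < invPot A ζ p} b x := by
  have hne := eventually_forall_ne hp
  have hsub : {y | ∀ i, y ≠ A i} ∩ {x | pot A ζ p < pot A ζ x} ⊆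
      {x | invPot A ζ x < invPot A ζ p} := fun x hx => (invPot_lt_of_pot_lt hζ hp hx.1).2 hx.2
  obtain ⟨K, _, μ, hμ, hL⟩ := exists_positive_subspace_of_trace_eq_zero
    (potHessian_isSymmetric (A := A) (ζ := ζ) p)
    (fun v hv h => hnd v hv (by
      rw [fderiv_fderiv_pot_apply hp, LinearIsometryEquiv.map_eq_zero_iff]; exact h))
    (trace_potHessian hp)
  obtain ⟨hcl, a, b, hab⟩ := exists_joinedIn_superlevel_of_nondegenerate hne
    (hne.mono fun x hx => hasGradientAt_pot (ζ := ζ) hx)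
    (hasFDerivAt_potGradient hp) ((fderiv_pot_eq_zero_iff hp).1 hcrit) K hμ hL
  refine ⟨closure_mono hsub hcl, a, b, ?_⟩
  filter_upwards [hab, hne] with x hx hxA hlt
  exact (hx ((invPot_lt_of_pot_lt hζ hp hxA).1 hlt)).imp (·.mono hsub) (·.mono hsub)

end MorseCount

/-- if all charges are positive and every critical point of `V` is
non-degenerate (the Hessian there is invertible, i.e. its associated linear map has
trivial kernel), then `V` has at least `n - 1` critical points. -/
theorem stmt6 (n : ℕ) (A : Fin n → E3) (hA : Function.Injective A)
    (ζ : Fin n → ℝ) (hζ : ∀ i, 0 < ζ i)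
    (hnd : ∀ x : E3, (∀ i, x ≠ A i) → fderiv ℝ (pot A ζ) x = 0 →
      ∀ v : E3, v ≠ 0 → fderiv ℝ (fderiv ℝ (pot A ζ)) x v ≠ 0) :
    ∃ T : Finset E3, n - 1 ≤ T.card ∧
      ∀ x ∈ T, (∀ i, x ≠ A i) ∧ fderiv ℝ (pot A ζ) x = 0 := by
  rcases Nat.eq_zero_or_pos n with rfl | hn
  · exact ⟨∅, by simp, by simp⟩
  have : NeZero n := ⟨hn.ne'⟩
  by_cases hfin : {x : E3 | (∀ i, x ≠ A i) ∧ fderiv ℝ (pot A ζ) x = 0}.Finite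
  · refine ⟨hfin.toFinset, ?_, fun x hx => hfin.mem_toFinset.1 hx⟩
    have hmem : ∀ p, p ∈ hfin.toFinset ↔ (∀ i, p ≠ A i) ∧ fderiv ℝ (pot A ζ) p = 0 :=
      fun p => hfin.mem_toFinset
    have hrange : ∀ p, p ∉ Set.range A → ∀ i, p ≠ A i := fun p hp i h => hp ⟨i, h.symm⟩
    have hcard := card_le_card_saddles_add_one hA (continuous_invPot hζ) (isCompact_invPot_le hζ)
      (fun _ => ENNReal.toReal_nonneg) (fun _ => invPot_eq_zero_iff hζ)
      (fun p hp => by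
        by_cases hcrit : fderiv ℝ (pot A ζ) p = 0
        · exact (exists_joinedIn_invPot_lt_of_critical hζ (hrange p hp) hcrit
            (hnd p (hrange p hp) hcrit)).1
        · exact (exists_joinedIn_invPot_lt_of_regular hζ (hrange p hp) hcrit).1)
      hfin.toFinset
      (fun p hp hpC => (exists_joinedIn_invPot_lt_of_regular hζ (hrange p hp)
        fun h => hpC ((hmem p).2 ⟨hrange p hp, h⟩)).2)
      (fun p hpC => (exists_joinedIn_invPot_lt_of_critical hζ ((hmem p).1 hpC).1 ((hmem p).1 hpC).2
        (hnd p ((hmem p).1 hpC).1 ((hmem p).1 hpC).2)).2)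
    rw [Nat.card_eq_fintype_card, Fintype.card_fin] at hcard
    omega
  · obtain ⟨T, hT, hTcard⟩ := Set.Infinite.exists_subset_card_eq hfin (n - 1)
    exact ⟨T, hTcard.ge, fun x hx => hT hx⟩
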